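/- arXiv:2303.18168 — 3 statements merged into one kernel-verified Lean document; each statement's English description precedes it below -/
import Mathlib

section
/- Let d ≥ 1, κ > 0, let U : ℝ^d → ℝ be C² and ℤ^d-periodic, and let μ be the probability measure on [0,1)^d with density ρ∞ = e^{-U/κ}/Z, Z = ∫_{[0,1)^d} e^{-U/κ} dx. Then every C¹ ℤ^d-periodic function f with ∫_{[0,1)^d} f dμ = 0 satisfies the weighted Poincaré inequality ‖∇f‖_{L²(μ)} ≥ 2π · exp(−‖U‖_osc/(2κ)) · ‖f‖_{L²(μ)}, where ‖U‖_osc = max U − min U. -/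
open MeasureTheory

/-- The fundamental domain `[0,1)^d` of the torus. -/
def box (d : ℕ) : Set (Fin d → ℝ) := Set.univ.pi fun _ => Set.Ico (0:ℝ) 1

/-- The `i`-th partial derivative of `f : ℝ^d → ℝ` at `x`. -/
noncomputable def pd (d : ℕ) (f : (Fin d → ℝ) → ℝ) (i : Fin d) (x : Fin d → ℝ) : ℝ :=
  fderiv ℝ f x (Pi.single i 1)

/-- `ℤ^d`-periodicity of a function on `ℝ^d`. -/
def Per (d : ℕ) (f : (Fin d → ℝ) → ℝ) : Prop :=
  ∀ x : Fin d → ℝ, ∀ m : Fin d → ℤ, f (x + fun i => (m i : ℝ)) = f x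

/-- The probability measure `μ` on `[0,1)^d` with density `ρ∞ = e^{-U/κ}/Z`. -/
noncomputable def μm (d : ℕ) (κ : ℝ) (U : (Fin d → ℝ) → ℝ) : Measure (Fin d → ℝ) :=
  (volume.restrict (box d)).withDensity fun x =>
    ENNReal.ofReal (Real.exp (-(U x) / κ) / ∫ y in box d, Real.exp (-(U y) / κ))

/-- The oscillation `‖U‖_osc = max U - min U` of a (bounded) function. -/
noncomputable def oscU (d : ℕ) (U : (Fin d → ℝ) → ℝ) : ℝ :=
  sSup (Set.range U) - sInf (Set.range U)

open Set

/-- Wirtinger's inequality: the variance of a `1`-periodic `C¹` function over a period is at most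
`(2π)⁻²` times the integral of the square of its derivative. -/
theorem four_pi_sq_mul_variance_le {f f' : ℝ → ℝ} (hf : ∀ x, HasDerivAt f (f' x) x)
    (hf' : Continuous f') (hper : f 1 = f 0) :
    4 * Real.pi ^ 2 * ((∫ x in Ico (0:ℝ) 1, f x ^ 2) - (∫ x in Ico (0:ℝ) 1, f x) ^ 2)
      ≤ ∫ x in Ico (0:ℝ) 1, f' x ^ 2 := by
  have hfc : Continuous f := continuous_iff_continuousAt.2 fun x => (hf x).continuousAt
  have hmem : ∀ g : ℝ → ℝ, Continuous g →
      MemLp (fun x => (g x : ℂ)) 2 (volume.restrict (Ioc (0:ℝ) 1)) := fun g hg => by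
    have hg' : Continuous fun x => (g x : ℂ) := Complex.continuous_ofReal.comp hg
    obtain ⟨C, hC⟩ := isCompact_Icc.exists_bound_of_continuousOn (s := Icc (0:ℝ) 1) hg'.continuousOn
    exact MemLp.of_bound hg'.aestronglyMeasurable C
      (ae_restrict_of_forall_mem measurableSet_Ioc fun x hx => hC x (Ioc_subset_Icc_self hx))
  have hparseval : ∀ g : ℝ → ℝ, Continuous g →
      HasSum (fun n => ‖fourierCoeffOn zero_lt_one (fun x => (g x : ℂ)) n‖ ^ 2)
        (∫ x in Ico (0:ℝ) 1, g x ^ 2) := fun g hg => by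
    have h := hasSum_sq_fourierCoeffOn zero_lt_one (hmem g hg)
    simpa [intervalIntegral.integral_of_le, integral_Ico_eq_integral_Ioc] using h
  have hzero : ‖fourierCoeffOn zero_lt_one (fun x => (f x : ℂ)) 0‖ ^ 2
      = (∫ x in Ico (0:ℝ) 1, f x) ^ 2 := by
    rw [fourierCoeffOn_eq_integral]
    simp [intervalIntegral.integral_of_le, integral_Ico_eq_integral_Ioc, integral_complex_ofReal]
  have hsum := hasSum_ite_sub_hasSum (hparseval f hfc) 0
  rw [hzero] at hsum
  refine hasSum_le (fun n => ?_) (hsum.mul_left (4 * Real.pi ^ 2)) (hparseval f' hf')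
  split_ifs with hn
  · simp
  have hn1 : (1:ℝ) ≤ (n:ℝ) ^ 2 := by
    exact_mod_cast (one_le_sq_iff_one_le_abs n).2 (Int.one_le_abs hn)
  have hint : IntervalIntegrable (fun x => (f' x : ℂ)) volume 0 1 :=
    (Complex.continuous_ofReal.comp hf').intervalIntegrable _ _
  rw [fourierCoeffOn_of_hasDerivAt zero_lt_one hn (fun x _ => (hf x).ofReal_comp) hint, hper]
  set A := fourierCoeffOn zero_lt_one (fun x => (f' x : ℂ)) n
  have hA : ‖A‖ ^ 2 * ((n:ℝ) ^ 2)⁻¹ ≤ ‖A‖ ^ 2 :=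
    mul_le_of_le_one_right (sq_nonneg _) (inv_le_one_of_one_le₀ hn1)
  refine le_trans (le_of_eq ?_) hA
  simp [mul_pow, abs_of_pos Real.pi_pos]
  field_simp
  norm_num

/-- The variance of a bounded function on a product of two probability spaces is at most the sum
of the averaged variances in each variable (Efron–Stein for two variables). -/
theorem integral_sq_add_sq_integral_ge {α β : Type*} [MeasurableSpace α] [MeasurableSpace β]
    (μ : Measure α) (ν : Measure β) [IsProbabilityMeasure μ] [IsProbabilityMeasure ν]
    {F : α × β → ℝ} (hF : StronglyMeasurable F) {C : ℝ} (hC : ∀ p, |F p| ≤ C) :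
    (∫ a, (∫ b, F (a, b) ∂ν) ^ 2 ∂μ) + ∫ b, (∫ a, F (a, b) ∂μ) ^ 2 ∂ν
      ≤ (∫ p, F p ^ 2 ∂μ.prod ν) + (∫ p, F p ∂μ.prod ν) ^ 2 := by
  set g : α → ℝ := fun a => ∫ b, F (a, b) ∂ν with hg
  set h : β → ℝ := fun b => ∫ a, F (a, b) ∂μ with hh
  set c : ℝ := ∫ p, F p ∂μ.prod ν with hc
  have hgm : StronglyMeasurable g := hF.integral_prod_right'
  have hhm : StronglyMeasurable h := hF.integral_prod_left'
  have hgC : ∀ a, ‖g a‖ ≤ C := fun a => by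
    simpa using norm_integral_le_of_norm_le_const (μ := ν) (f := fun b => F (a, b)) (Filter.Eventually.of_forall
      fun b => hC (a, b))
  have hhC : ∀ b, ‖h b‖ ≤ C := fun b => by
    simpa using norm_integral_le_of_norm_le_const (μ := μ) (f := fun a => F (a, b)) (Filter.Eventually.of_forall
      fun a => hC (a, b))
  have mF : MemLp F 2 (μ.prod ν) := .of_bound hF.aestronglyMeasurable C (.of_forall hC)
  have mg : MemLp (fun p : α × β => g p.1) 2 (μ.prod ν) :=
    .of_bound (hgm.comp_measurable measurable_fst).aestronglyMeasurable C (.of_forall fun p => hgC _)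
  have mh : MemLp (fun p : α × β => h p.2) 2 (μ.prod ν) :=
    .of_bound (hhm.comp_measurable measurable_snd).aestronglyMeasurable C (.of_forall fun p => hhC _)
  have iF : Integrable F (μ.prod ν) := mF.integrable one_le_two
  have hgg : ∫ p : α × β, g p.1 ^ 2 ∂μ.prod ν = ∫ a, g a ^ 2 ∂μ := by
    simpa using integral_fun_fst (μ := μ) (ν := ν) (fun a => g a ^ 2)
  have hhh : ∫ p : α × β, h p.2 ^ 2 ∂μ.prod ν = ∫ b, h b ^ 2 ∂ν := by
    simpa using integral_fun_snd (μ := μ) (ν := ν) (fun b => h b ^ 2)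
  have hFg : ∫ p : α × β, F p * g p.1 ∂μ.prod ν = ∫ a, g a ^ 2 ∂μ := by
    refine (integral_prod _ (mF.integrable_mul mg)).trans ?_
    simp only [Pi.mul_apply, integral_mul_const, sq, hg]
  have hFh : ∫ p : α × β, F p * h p.2 ∂μ.prod ν = ∫ b, h b ^ 2 ∂ν := by
    refine (integral_prod_symm _ (mF.integrable_mul mh)).trans ?_
    simp only [Pi.mul_apply, integral_mul_const, sq, hh]
  have hg1 : ∫ a, g a ∂μ = c := (integral_prod _ iF).symm
  have hh1 : ∫ b, h b ∂ν = c := (integral_prod_symm _ iF).symm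
  have hgh : ∫ p : α × β, g p.1 * h p.2 ∂μ.prod ν = c ^ 2 := by
    rw [integral_prod_mul, hg1, hh1, sq]
  have hexp : ∫ p : α × β, (F p + c - g p.1 - h p.2) ^ 2 ∂μ.prod ν
      = (∫ p, F p ^ 2 ∂μ.prod ν) + c ^ 2 - (∫ a, g a ^ 2 ∂μ) - ∫ b, h b ^ 2 ∂ν := by
    have hgc : ∫ p : α × β, g p.1 ∂μ.prod ν = c := by
      simpa [hg1] using integral_fun_fst (μ := μ) (ν := ν) g
    have hhc : ∫ p : α × β, h p.2 ∂μ.prod ν = c := by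
      simpa [hh1] using integral_fun_snd (μ := μ) (ν := ν) h
    have e : ∀ p : α × β, (F p + c - g p.1 - h p.2) ^ 2 =
        F p ^ 2 + g p.1 ^ 2 + h p.2 ^ 2 + c ^ 2 + 2 * c * F p - 2 * c * g p.1 - 2 * c * h p.2
          - 2 * (F p * g p.1) - 2 * (F p * h p.2) + 2 * (g p.1 * h p.2) := fun p => by ring
    have i1 := mF.integrable_sq
    have i2 := mg.integrable_sq
    have i3 := mh.integrable_sq
    have i4 : Integrable (fun _ : α × β => c ^ 2) (μ.prod ν) := integrable_const _
    have i5 := iF.const_mul (2 * c)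
    have i6 := (mg.integrable one_le_two).const_mul (2 * c)
    have i7 := (mh.integrable one_le_two).const_mul (2 * c)
    have i8 : Integrable (fun p : α × β => 2 * (F p * g p.1)) (μ.prod ν) :=
      (mF.integrable_mul mg).const_mul 2
    have i9 : Integrable (fun p : α × β => 2 * (F p * h p.2)) (μ.prod ν) :=
      (mF.integrable_mul mh).const_mul 2
    have i10 : Integrable (fun p : α × β => 2 * (g p.1 * h p.2)) (μ.prod ν) :=
      (mg.integrable_mul mh).const_mul 2
    simp_rw [e]
    rw [integral_add (by fun_prop) i10, integral_sub (by fun_prop) i9,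
      integral_sub (by fun_prop) i8, integral_sub (by fun_prop) i7, integral_sub (by fun_prop) i6,
      integral_add (by fun_prop) i5, integral_add (by fun_prop) i4, integral_add (by fun_prop) i3,
      integral_add i1 i2]
    simp only [integral_const_mul, hFg, hFh, hgh, hgg, hhh, hgc, hhc, ← hc]
    simp
    ring
  have hpos : 0 ≤ ∫ p : α × β, (F p + c - g p.1 - h p.2) ^ 2 ∂μ.prod ν :=
    integral_nonneg fun p => sq_nonneg _
  linarith

theorem restrict_box_eq_pi (n : ℕ) : (volume : Measure (Fin n → ℝ)).restrict (box n)
    = Measure.pi fun _ => volume.restrict (Ico (0:ℝ) 1) :=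
  Measure.restrict_pi_pi _ _

theorem isProbabilityMeasure_restrict_Ico :
    IsProbabilityMeasure ((volume : Measure ℝ).restrict (Ico (0:ℝ) 1)) := ⟨by simp⟩

theorem isProbabilityMeasure_restrict_box (n : ℕ) :
    IsProbabilityMeasure ((volume : Measure (Fin n → ℝ)).restrict (box n)) := by
  have := isProbabilityMeasure_restrict_Ico
  rw [restrict_box_eq_pi]
  infer_instance

theorem box_subset_Icc (n : ℕ) : box n ⊆ Icc 0 1 :=
  fun _ hx => ⟨fun i => (hx i trivial).1, fun i => (hx i trivial).2.le⟩

theorem measurableSet_box (n : ℕ) : MeasurableSet (box n) :=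
  MeasurableSet.univ_pi fun _ => measurableSet_Ico

theorem Continuous.integrableOn_box {n : ℕ} {f : (Fin n → ℝ) → ℝ} (hf : Continuous f) :
    Integrable f (volume.restrict (box n)) :=
  (hf.integrableOn_Icc (a := 0) (b := 1)).mono_set (box_subset_Icc n)

/-- Every value of a periodic function is taken on the fundamental domain. -/
theorem Per.exists_mem_box {n : ℕ} {f : (Fin n → ℝ) → ℝ} (hf : Per n f) (x : Fin n → ℝ) :
    ∃ y ∈ box n, f y = f x := by
  refine ⟨fun i => Int.fract (x i), fun i _ => ⟨Int.fract_nonneg _, Int.fract_lt_one _⟩, ?_⟩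
  rw [← hf _ fun i => ⌊x i⌋]
  congr 1
  ext i
  exact Int.fract_add_floor (x i)

theorem Per.exists_bound {n : ℕ} {f : (Fin n → ℝ) → ℝ} (hf : Per n f) (hc : Continuous f) :
    ∃ C, ∀ x, |f x| ≤ C := by
  obtain ⟨C, hC⟩ := isCompact_Icc.exists_bound_of_continuousOn
    (s := Icc (0 : Fin n → ℝ) 1) hc.continuousOn
  refine ⟨C, fun x => ?_⟩
  obtain ⟨y, hy, hyx⟩ := hf.exists_mem_box x
  exact hyx ▸ hC y (box_subset_Icc n hy)

theorem measurePreserving_cons (n : ℕ) :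
    MeasurePreserving (fun p : ℝ × (Fin n → ℝ) => (Fin.cons p.1 p.2 : Fin (n + 1) → ℝ))
      ((volume.restrict (Ico (0:ℝ) 1)).prod (volume.restrict (box n)))
      (volume.restrict (box (n + 1))) := by
  have := (measurePreserving_piFinSuccAbove
    (fun _ : Fin (n + 1) => (volume : Measure ℝ).restrict (Ico (0:ℝ) 1)) 0).symm
  rw [restrict_box_eq_pi, restrict_box_eq_pi]
  convert! this using 1
  funext p
  exact (Fin.insertNth_zero (α := fun _ => ℝ) p.1 p.2).symm

theorem continuous_cons (n : ℕ) :
    Continuous fun p : ℝ × (Fin n → ℝ) => (Fin.cons p.1 p.2 : Fin (n + 1) → ℝ) :=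
  continuous_fst.finCons (A := fun _ => ℝ) continuous_snd

theorem integral_box_succ (n : ℕ) {f : (Fin (n + 1) → ℝ) → ℝ} (hf : Continuous f) :
    ∫ x in box (n + 1), f x = ∫ p : ℝ × (Fin n → ℝ), f (Fin.cons p.1 p.2)
      ∂(volume.restrict (Ico (0:ℝ) 1)).prod (volume.restrict (box n)) := by
  rw [← (measurePreserving_cons n).map_eq, integral_map (continuous_cons n).aemeasurable
    hf.aestronglyMeasurable]

theorem integrable_comp_cons (n : ℕ) {f : (Fin (n + 1) → ℝ) → ℝ} (hf : Continuous f) :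
    Integrable (fun p : ℝ × (Fin n → ℝ) => f (Fin.cons p.1 p.2))
      ((volume.restrict (Ico (0:ℝ) 1)).prod (volume.restrict (box n))) :=
  (measurePreserving_cons n).integrable_comp_of_integrable hf.integrableOn_box

theorem hasDerivAt_comp_cons {n : ℕ} {f : (Fin (n + 1) → ℝ) → ℝ} (hf : ContDiff ℝ 1 f)
    (t : ℝ) (y : Fin n → ℝ) :
    HasDerivAt (fun s => f (Fin.cons s y)) (pd (n + 1) f 0 (Fin.cons t y)) t := by
  have h1 : HasDerivAt (fun s => (Fin.cons s y : Fin (n + 1) → ℝ)) (Pi.single 0 1) t := by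
    rw [hasDerivAt_pi]
    intro i
    refine Fin.cases ?_ (fun j => ?_) i
    · simpa using hasDerivAt_id' t
    · simpa using hasDerivAt_const t (y j)
  exact ((hf.differentiable one_ne_zero _).hasFDerivAt).comp_hasDerivAt t h1

theorem contDiff_cons_right {n : ℕ} (t : ℝ) :
    ContDiff ℝ 1 fun y : Fin n → ℝ => (Fin.cons t y : Fin (n + 1) → ℝ) := by
  rw [contDiff_pi]
  intro i
  refine Fin.cases ?_ (fun j => ?_) i
  · simpa using contDiff_const
  · simpa using contDiff_apply ℝ ℝ j

theorem pd_comp_cons {n : ℕ} {f : (Fin (n + 1) → ℝ) → ℝ} (hf : ContDiff ℝ 1 f)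
    (t : ℝ) (y : Fin n → ℝ) (i : Fin n) :
    pd n (fun z => f (Fin.cons t z)) i y = pd (n + 1) f i.succ (Fin.cons t y) := by
  have h1 : HasFDerivAt (fun z : Fin n → ℝ => (Fin.cons t z : Fin (n + 1) → ℝ))
      (ContinuousLinearMap.pi fun j : Fin (n + 1) =>
        Fin.cases (motive := fun _ => (Fin n → ℝ) →L[ℝ] ℝ) 0
          (fun j => ContinuousLinearMap.proj j) j) y := by
    rw [hasFDerivAt_pi]
    intro j
    refine Fin.cases ?_ (fun j => ?_) j
    · simpa using hasFDerivAt_const t y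
    · simpa using hasFDerivAt_apply j y
  have h2 := ((hf.differentiable one_ne_zero (Fin.cons t y)).hasFDerivAt).comp y h1
  rw [pd, pd]
  refine (congrArg (fun L => L (Pi.single i 1)) h2.fderiv).trans ?_
  rw [ContinuousLinearMap.comp_apply]
  congr 1
  ext j
  refine Fin.cases ?_ (fun j => ?_) j
  · simp
  · simp [Pi.single_apply]

theorem continuous_pd {n : ℕ} {f : (Fin n → ℝ) → ℝ} (hf : ContDiff ℝ 1 f) (i : Fin n) :
    Continuous (pd n f i) :=
  (hf.continuous_fderiv one_ne_zero).clm_apply continuous_const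

/-- The sharp Poincaré inequality on the unit torus, for Lebesgue measure. -/
theorem Per.poincare_box (n : ℕ) {f : (Fin n → ℝ) → ℝ} (hf : ContDiff ℝ 1 f) (hper : Per n f) :
    4 * Real.pi ^ 2 * ((∫ x in box n, f x ^ 2) - (∫ x in box n, f x) ^ 2)
      ≤ ∫ x in box n, ∑ i, pd n f i x ^ 2 := by
  have := isProbabilityMeasure_restrict_Ico
  induction n with
  | zero =>
    have := isProbabilityMeasure_restrict_box 0
    simp [integral_unique]
  | succ n ih =>
    have := isProbabilityMeasure_restrict_box n
    set μ := (volume : Measure ℝ).restrict (Ico (0:ℝ) 1)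
    set ν := (volume : Measure (Fin n → ℝ)).restrict (box n)
    have hfc := hf.continuous
    obtain ⟨C, hC⟩ := hper.exists_bound hfc
    have hfsq : Continuous fun x => f x ^ 2 := hfc.pow 2
    have hpd := fun i => continuous_pd hf i
    have hpdsq : ∀ i, Continuous fun x => pd (n + 1) f i x ^ 2 := fun i => (hpd i).pow 2
    have hF := hfc.comp (continuous_cons n)
    have key := integral_sq_add_sq_integral_ge μ ν
      (F := fun p => f (Fin.cons p.1 p.2)) hF.stronglyMeasurable fun p => hC _
    rw [integral_box_succ n hfsq, integral_box_succ n hfc,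
      integral_box_succ n (continuous_finsetSum _ fun i _ => hpdsq i)]
    have i0 := integrable_comp_cons n (hpdsq 0)
    have i1 := integrable_comp_cons n
      (continuous_finsetSum Finset.univ fun (i : Fin n) _ => hpdsq i.succ)
    have iF := integrable_comp_cons n hfsq
    have ig : Integrable (fun t => (∫ y, f (Fin.cons t y) ∂ν) ^ 2) μ := by
      refine (MemLp.of_bound (p := 2) (C := C) (f := fun t => ∫ y, f (Fin.cons t y) ∂ν) ?_
        (.of_forall fun t => ?_)).integrable_sq
      · exact (hF.stronglyMeasurable.integral_prod_right' (ν := ν)).aestronglyMeasurable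
      · simpa using norm_integral_le_of_norm_le_const (μ := ν) (f := fun y => f (Fin.cons t y)) (.of_forall
          fun y => hC (Fin.cons t y))
    have ih' : Integrable (fun y => (∫ t, f (Fin.cons t y) ∂μ) ^ 2) ν := by
      refine (MemLp.of_bound (p := 2) (C := C) (f := fun y => ∫ t, f (Fin.cons t y) ∂μ) ?_
        (.of_forall fun y => ?_)).integrable_sq
      · exact (hF.stronglyMeasurable.integral_prod_left' (μ := μ)).aestronglyMeasurable
      · simpa using norm_integral_le_of_norm_le_const (μ := μ) (f := fun t => f (Fin.cons t y)) (.of_forall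
          fun t => hC (Fin.cons t y))
    have h1 : 4 * Real.pi ^ 2 * ((∫ p : ℝ × (Fin n → ℝ), f (Fin.cons p.1 p.2) ^ 2 ∂μ.prod ν)
          - ∫ t, (∫ y, f (Fin.cons t y) ∂ν) ^ 2 ∂μ)
        ≤ ∫ p : ℝ × (Fin n → ℝ), ∑ i : Fin n, pd (n + 1) f i.succ (Fin.cons p.1 p.2) ^ 2
          ∂μ.prod ν := by
      rw [integral_prod _ iF, integral_prod _ i1, ← integral_sub iF.integral_prod_left ig,
        ← integral_const_mul]
      refine integral_mono ((iF.integral_prod_left.sub ig).const_mul _) i1.integral_prod_left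
        fun t => ?_
      have hp : Per n fun y => f (Fin.cons t y) := fun y m => by
        refine Eq.trans ?_ (hper (Fin.cons t y) (Fin.cons 0 m))
        refine congrArg f ?_
        ext i
        refine Fin.cases ?_ (fun j => ?_) i <;> simp
      have h := ih (f := fun y => f (Fin.cons t y)) (hf.comp (contDiff_cons_right t)) hp
      simp only [pd_comp_cons hf] at h
      exact h
    have h2 : 4 * Real.pi ^ 2 * ((∫ p : ℝ × (Fin n → ℝ), f (Fin.cons p.1 p.2) ^ 2 ∂μ.prod ν)
          - ∫ y, (∫ t, f (Fin.cons t y) ∂μ) ^ 2 ∂ν)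
        ≤ ∫ p : ℝ × (Fin n → ℝ), pd (n + 1) f 0 (Fin.cons p.1 p.2) ^ 2 ∂μ.prod ν := by
      rw [integral_prod_symm _ iF, integral_prod_symm _ i0,
        ← integral_sub iF.integral_prod_right ih', ← integral_const_mul]
      refine integral_mono ((iF.integral_prod_right.sub ih').const_mul _) i0.integral_prod_right
        fun y => ?_
      refine four_pi_sq_mul_variance_le (fun t => hasDerivAt_comp_cons hf t y)
        ((hpd 0).comp ((continuous_cons n).comp (Continuous.prodMk_left y))) ?_
      rw [← hper (Fin.cons 0 y) (Fin.cons 1 0)]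
      congr 1
      ext i
      refine Fin.cases ?_ (fun j => ?_) i <;> simp
    simp only [Fin.sum_univ_succ]
    rw [integral_add i0 i1]
    have hpi : 0 ≤ 4 * Real.pi ^ 2 := by positivity
    nlinarith [mul_le_mul_of_nonneg_left key hpi]

/-- the weighted Poincaré inequality
`‖∇f‖_{L²(μ)} ≥ 2π exp(-‖U‖_osc/(2κ)) ‖f‖_{L²(μ)}` for every μ-mean-zero
periodic C¹ function `f`. -/
theorem stmt_8 (d : ℕ) (hd : 1 ≤ d) (κ : ℝ) (hκ : 0 < κ)
    (U : (Fin d → ℝ) → ℝ) (hU : ContDiff ℝ 2 U) (hUper : Per d U)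
    (f : (Fin d → ℝ) → ℝ) (hf : ContDiff ℝ 1 f) (hfper : Per d f)
    (hmean : ∫ x, f x ∂(μm d κ U) = 0) :
    Real.sqrt (∫ x, (∑ i, (pd d f i x) ^ 2) ∂(μm d κ U))
      ≥ 2 * Real.pi * Real.exp (-oscU d U / (2 * κ)) *
          Real.sqrt (∫ x, (f x) ^ 2 ∂(μm d κ U)) := by
  have hprob := isProbabilityMeasure_restrict_box d
  have hUc := hU.continuous
  have hfc := hf.continuous
  set w : (Fin d → ℝ) → ℝ := fun x => Real.exp (-(U x) / κ) with hw
  have hwc : Continuous w := by fun_prop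
  set Z : ℝ := ∫ y in box d, w y with hZ
  have hZpos : 0 < Z := integral_exp_pos hwc.integrableOn_box
  have hμ : ∀ g : (Fin d → ℝ) → ℝ,
      ∫ x, g x ∂(μm d κ U) = Z⁻¹ * ∫ x in box d, w x * g x := fun g => by
    rw [μm, integral_withDensity_eq_integral_toReal_smul (by fun_prop)
      (.of_forall fun _ => ENNReal.ofReal_lt_top), ← integral_const_mul]
    refine integral_congr_ae (.of_forall fun x => ?_)
    simp only [smul_eq_mul]
    rw [ENNReal.toReal_ofReal (by positivity)]
    change w x / Z * g x = _
    ring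
  obtain ⟨C, hC⟩ := hUper.exists_bound hUc
  have hUabove : BddAbove (range U) := ⟨C, by rintro _ ⟨x, rfl⟩; exact (abs_le.1 (hC x)).2⟩
  have hUbelow : BddBelow (range U) := ⟨-C, by rintro _ ⟨x, rfl⟩; exact (abs_le.1 (hC x)).1⟩
  set a := Real.exp (-sSup (range U) / κ) with ha
  set b := Real.exp (-sInf (range U) / κ) with hb
  have hlow : ∀ x, a ≤ w x := fun x => by
    have := le_csSup hUabove (mem_range_self x)
    simp only [ha, hw]; gcongr
  have hhigh : ∀ x, w x ≤ b := fun x => by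
    have := csInf_le hUbelow (mem_range_self x)
    simp only [hb, hw]; gcongr
  set c := ∫ x in box d, f x with hc
  set G : (Fin d → ℝ) → ℝ := fun x => ∑ i, (pd d f i x) ^ 2 with hG
  have hGc : Continuous G := continuous_finsetSum _ fun i _ => (continuous_pd hf i).pow 2
  have hwf : ∫ x in box d, w x * f x = 0 := by
    rw [hμ] at hmean
    exact (mul_eq_zero.1 hmean).resolve_left (inv_ne_zero hZpos.ne')
  have hcenter : ∫ x in box d, w x * f x ^ 2 ≤ ∫ x in box d, w x * (f x - c) ^ 2 := by
    have e : ∀ x, w x * (f x - c) ^ 2 = w x * f x ^ 2 + c ^ 2 * w x - 2 * c * (w x * f x) :=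
      fun x => by ring
    simp_rw [e]
    rw [integral_sub (Continuous.integrableOn_box (by fun_prop))
        (Continuous.integrableOn_box (by fun_prop)),
      integral_add (Continuous.integrableOn_box (by fun_prop))
        (Continuous.integrableOn_box (by fun_prop)), integral_const_mul, integral_const_mul, hwf]
    nlinarith [mul_nonneg (sq_nonneg c) hZpos.le]
  have hvar : ∫ x in box d, (f x - c) ^ 2 = (∫ x in box d, f x ^ 2) - c ^ 2 := by
    have e : ∀ x, (f x - c) ^ 2 = f x ^ 2 + c ^ 2 - 2 * c * f x := fun x => by ring
    simp_rw [e]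
    rw [integral_sub (Continuous.integrableOn_box (by fun_prop))
        (Continuous.integrableOn_box (by fun_prop)),
      integral_add (Continuous.integrableOn_box (by fun_prop)) (integrable_const _),
      integral_const_mul, ← hc, integral_const]
    simp
    ring
  have hupper : ∫ x in box d, w x * (f x - c) ^ 2 ≤ b * ∫ x in box d, (f x - c) ^ 2 := by
    rw [← integral_const_mul]
    exact integral_mono (Continuous.integrableOn_box (by fun_prop))
      (Continuous.integrableOn_box (by fun_prop))
      fun x => mul_le_mul_of_nonneg_right (hhigh x) (sq_nonneg _)
  have hlower : a * ∫ x in box d, G x ≤ ∫ x in box d, w x * G x := by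
    rw [← integral_const_mul]
    exact integral_mono (Continuous.integrableOn_box (by fun_prop))
      (Continuous.integrableOn_box (by fun_prop))
      fun x => mul_le_mul_of_nonneg_right (hlow x) (Finset.sum_nonneg fun i _ => sq_nonneg _)
  have hpoincare := hfper.poincare_box d hf
  rw [← hvar] at hpoincare
  have hexp : Real.exp (-oscU d U / (2 * κ)) ^ 2 * b = a := by
    rw [ha, hb, ← Real.exp_nat_mul, ← Real.exp_add, oscU]
    congr 1
    field_simp
    push_cast
    ring
  set r := Real.exp (-oscU d U / (2 * κ)) with hr
  have hmain : (2 * Real.pi * r) ^ 2 * (∫ x in box d, w x * f x ^ 2)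
      ≤ ∫ x in box d, w x * G x := by
    calc (2 * Real.pi * r) ^ 2 * (∫ x in box d, w x * f x ^ 2)
        ≤ (2 * Real.pi * r) ^ 2 * (b * ∫ x in box d, (f x - c) ^ 2) := by
          gcongr; exact hcenter.trans hupper
      _ = (r ^ 2 * b) * (4 * Real.pi ^ 2 * ∫ x in box d, (f x - c) ^ 2) := by ring
      _ ≤ a * ∫ x in box d, G x := by
          rw [hexp]; gcongr
      _ ≤ _ := hlower
  rw [ge_iff_le, hμ, hμ]
  refine Real.le_sqrt_of_sq_le ?_
  rw [mul_pow, Real.sq_sqrt (mul_nonneg (inv_nonneg.2 hZpos.le)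
    (integral_nonneg fun x => mul_nonneg (Real.exp_pos _).le (sq_nonneg _))), mul_left_comm]
  gcongr
end

section
/- Let μ be the probability measure on [0,1)^d with strictly positive measurable density ρ∞ with respect to Lebesgue measure. Let k : [0,1)^d × [0,1)^d → [0,∞) be measurable with ∫ k(x,y) dy = 1 for every x and ∫ k(x,y) ρ∞(x) dx = ρ∞(y) for almost every y (i.e. k is a Markov kernel with invariant density ρ∞). Suppose that for some ε ∈ (0,1], sup_x ∫ |k(x,y) − ρ∞(y)| dy ≤ ε. Then for every bounded measurable f with ∫ f dμ = 0, the function θ(x) := ∫ k(x,y) f(y) dy satisfies ‖θ‖²_{L²(μ)} ≤ 2 ε ‖f‖²_{L²(μ)}. -/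
open MeasureTheory

/-- The measure on `[0,1)^d` with density `ρ` with respect to Lebesgue measure. -/
noncomputable def densMeas (d : ℕ) (ρ : (Fin d → ℝ) → ℝ) : Measure (Fin d → ℝ) :=
  (volume.restrict (box d)).withDensity fun x => ENNReal.ofReal (ρ x)

/-- Weighted Cauchy–Schwarz inequality with a signed weight `g`. -/
lemma sq_integral_mul_le_integral_abs_mul {α : Type*} [MeasurableSpace α] {ν : Measure α}
    {g f : α → ℝ} (hg : Integrable g ν) (hf : Measurable f) {M : ℝ} (hM : ∀ y, |f y| ≤ M) :
    (∫ y, g y * f y ∂ν) ^ 2 ≤ (∫ y, |g y| ∂ν) * ∫ y, |g y| * f y ^ 2 ∂ν := by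
  have h1 : Integrable (fun y => |g y| * |f y|) ν :=
    hg.abs.mul_bdd (c := M) hf.abs.aestronglyMeasurable (.of_forall fun y => by simpa using hM y)
  have h2 : Integrable (fun y => |g y| * f y ^ 2) ν :=
    hg.abs.mul_bdd (c := M ^ 2) (hf.pow_const 2).aestronglyMeasurable (.of_forall fun y => by
      simpa using pow_le_pow_left₀ (abs_nonneg _) (hM y) 2)
  have hquad : ∀ t : ℝ, 0 ≤ (∫ y, |g y| ∂ν) * (t * t) + (-2 * ∫ y, |g y| * |f y| ∂ν) * t
      + ∫ y, |g y| * f y ^ 2 ∂ν := fun t => by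
    have h : 0 ≤ ∫ y, |g y| * (t * t) + -2 * (|g y| * |f y|) * t + |g y| * f y ^ 2 ∂ν :=
      integral_nonneg fun y => by
        have : |g y| * (t * t) + -2 * (|g y| * |f y|) * t + |g y| * f y ^ 2
            = |g y| * (t - |f y|) ^ 2 := by
          rw [← sq_abs (f y)]; ring
        simp only [Pi.zero_apply, this]
        positivity
    have h3 : Integrable (fun y => |g y| * (t * t)) ν := hg.abs.mul_const _
    have h4 : Integrable (fun y => -2 * (|g y| * |f y|) * t) ν := (h1.const_mul _).mul_const _
    have h34 : Integrable (fun y => |g y| * (t * t) + -2 * (|g y| * |f y|) * t) ν := h3.add h4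
    rwa [integral_add h34 h2, integral_add h3 h4, integral_mul_const, integral_mul_const,
      integral_const_mul] at h
  have hdisc := discrim_le_zero hquad
  rw [discrim] at hdisc
  have habs : |∫ y, g y * f y ∂ν| ≤ ∫ y, |g y| * |f y| ∂ν := by
    simpa only [abs_mul] using abs_integral_le_integral_abs (f := fun y => g y * f y) (μ := ν)
  have hsq := pow_le_pow_left₀ (abs_nonneg _) habs 2
  rw [sq_abs] at hsq
  linarith

lemma integral_densMeas {d : ℕ} {ρ : (Fin d → ℝ) → ℝ} (hρ : Measurable ρ) (hpos : ∀ x, 0 < ρ x)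
    (g : (Fin d → ℝ) → ℝ) : ∫ x, g x ∂(densMeas d ρ) = ∫ x in box d, ρ x * g x := by
  rw [densMeas, integral_withDensity_eq_integral_toReal_smul hρ.ennreal_ofReal
    (.of_forall fun _ => ENNReal.ofReal_lt_top)]
  simp [ENNReal.toReal_ofReal (hpos _).le]

/-- if `k` is a Markov kernel with invariant density `ρ∞` which is
uniformly within total-variation distance `ε` of stationarity, then for every bounded
measurable μ-mean-zero `f`, the function `θ(x) = ∫ k(x,y) f(y) dy` satisfies
`‖θ‖²_{L²(μ)} ≤ 2ε ‖f‖²_{L²(μ)}`. -/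
theorem stmt_14 (d : ℕ) (ρ : (Fin d → ℝ) → ℝ)
    (hρm : Measurable ρ) (hρpos : ∀ x, 0 < ρ x)
    (hμprob : IsProbabilityMeasure (densMeas d ρ))
    (k : (Fin d → ℝ) → (Fin d → ℝ) → ℝ)
    (hkm : Measurable fun p : (Fin d → ℝ) × (Fin d → ℝ) => k p.1 p.2)
    (hknonneg : ∀ x y, 0 ≤ k x y)
    (hkmarkov : ∀ x, (∫ y in box d, k x y) = 1)
    (hkinv : ∀ᵐ y ∂(volume.restrict (box d)),
      (∫ x in box d, k x y * ρ x) = ρ y)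
    (ε : ℝ) (hε : ε ∈ Set.Ioc (0:ℝ) 1)
    (hktv : ∀ x, (∫ y in box d, |k x y - ρ y|) ≤ ε)
    (f : (Fin d → ℝ) → ℝ) (hfm : Measurable f)
    (M : ℝ) (hfbdd : ∀ y, |f y| ≤ M)
    (hfmean : ∫ x, f x ∂(densMeas d ρ) = 0) :
    ∫ x, (∫ y in box d, k x y * f y) ^ 2 ∂(densMeas d ρ)
      ≤ 2 * ε * ∫ x, (f x) ^ 2 ∂(densMeas d ρ) := by
  have hint := integral_densMeas hρm hρpos
  have hρone : ∫ x in box d, ρ x = 1 := by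
    have := hint fun _ => 1
    simpa using this.symm
  rw [hint] at hfmean
  rw [hint, hint]
  set ν : Measure (Fin d → ℝ) := volume.restrict (box d)
  have hρi : Integrable ρ ν := Integrable.of_integral_ne_zero (by simp [hρone])
  have hki : ∀ x, Integrable (k x) ν := fun x =>
    Integrable.of_integral_ne_zero (by rw [hkmarkov x]; exact one_ne_zero)
  have hf2 : ∀ y, ‖f y ^ 2‖ ≤ M ^ 2 := fun y => by
    simpa using pow_le_pow_left₀ (abs_nonneg _) (hfbdd y) 2
  have mulf : ∀ g : (Fin d → ℝ) → ℝ, Integrable g ν → Integrable (fun y => g y * f y) ν :=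
    fun g hg => hg.mul_bdd (c := M) hfm.aestronglyMeasurable (.of_forall hfbdd)
  have mulf2 : ∀ g : (Fin d → ℝ) → ℝ, Integrable g ν → Integrable (fun y => g y * f y ^ 2) ν :=
    fun g hg => hg.mul_bdd (c := M ^ 2) (hfm.pow_const 2).aestronglyMeasurable (.of_forall hf2)
  set c := ∫ y, ρ y * f y ^ 2 ∂ν with hc
  have hpt : ∀ x, (∫ y, k x y * f y ∂ν) ^ 2 ≤ ε * ((∫ y, k x y * f y ^ 2 ∂ν) + c) := fun x => by
    have hcentre : ∫ y, k x y * f y ∂ν = ∫ y, (k x y - ρ y) * f y ∂ν := by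
      simp only [sub_mul]
      rw [integral_sub (mulf _ (hki x)) (mulf _ hρi), hfmean, sub_zero]
    have hle : ∫ y, |k x y - ρ y| * f y ^ 2 ∂ν ≤ (∫ y, k x y * f y ^ 2 ∂ν) + c := by
      rw [hc, ← integral_add (mulf2 _ (hki x)) (mulf2 _ hρi)]
      refine integral_mono (mulf2 _ ((hki x).sub hρi).abs)
        ((mulf2 _ (hki x)).add (mulf2 _ hρi)) fun y => ?_
      simp only [← add_mul]
      refine mul_le_mul_of_nonneg_right ?_ (sq_nonneg _)
      rw [abs_le]
      constructor <;> linarith [hknonneg x y, hρpos y]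
    rw [hcentre]
    exact (sq_integral_mul_le_integral_abs_mul ((hki x).sub hρi) hfm hfbdd).trans
      (mul_le_mul (hktv x) hle (integral_nonneg fun y => by positivity) hε.1.le)
  have hjoint : Integrable (Function.uncurry fun x y => ρ x * (k x y * f y ^ 2)) (ν.prod ν) := by
    have hm : Measurable (Function.uncurry fun x y => ρ x * (k x y * f y ^ 2)) :=
      (hρm.comp measurable_fst).mul (hkm.mul ((hfm.comp measurable_snd).pow_const 2))
    refine (integrable_prod_iff hm.aestronglyMeasurable).2
      ⟨.of_forall fun x => (mulf2 _ (hki x)).const_mul (ρ x), ?_⟩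
    refine (hρi.mul_const (M ^ 2)).mono'
      hm.norm.stronglyMeasurable.integral_prod_right.aestronglyMeasurable (.of_forall fun x => ?_)
    rw [Real.norm_of_nonneg (integral_nonneg fun y => norm_nonneg _)]
    have hnorm : ∀ y, ‖Function.uncurry (fun x y => ρ x * (k x y * f y ^ 2)) (x, y)‖
        = ρ x * (k x y * f y ^ 2) := fun y => Real.norm_of_nonneg
      (mul_nonneg (hρpos x).le (mul_nonneg (hknonneg x y) (sq_nonneg _)))
    simp only [hnorm, integral_const_mul]
    refine mul_le_mul_of_nonneg_left ?_ (hρpos x).le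
    calc ∫ y, k x y * f y ^ 2 ∂ν ≤ ∫ y, k x y * M ^ 2 ∂ν :=
          integral_mono (mulf2 _ (hki x)) ((hki x).mul_const _) fun y =>
            mul_le_mul_of_nonneg_left ((le_abs_self _).trans (hf2 y)) (hknonneg x y)
      _ = M ^ 2 := by rw [integral_mul_const, hkmarkov x, one_mul]
  have hinv : ∫ x, ρ x * ∫ y, k x y * f y ^ 2 ∂ν ∂ν = c := by
    simp only [← integral_const_mul]
    rw [integral_integral_swap hjoint]
    refine integral_congr_ae ?_
    filter_upwards [hkinv] with y hy
    rw [← hy, ← integral_mul_const]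
    exact integral_congr_ae (.of_forall fun x => by ring)
  have houter : Integrable (fun x => ρ x * ∫ y, k x y * f y ^ 2 ∂ν) ν := by
    simpa only [Function.uncurry_apply_pair, integral_const_mul] using hjoint.integral_prod_left
  calc ∫ x, ρ x * (∫ y, k x y * f y ∂ν) ^ 2 ∂ν
      ≤ ∫ x, ε * (ρ x * (∫ y, k x y * f y ^ 2 ∂ν) + ρ x * c) ∂ν := by
        refine integral_mono_of_nonneg
          (.of_forall fun x => mul_nonneg (hρpos x).le (sq_nonneg _))
          ((houter.add (hρi.mul_const c)).const_mul ε) (.of_forall fun x => ?_)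
        calc ρ x * (∫ y, k x y * f y ∂ν) ^ 2
            ≤ ρ x * (ε * ((∫ y, k x y * f y ^ 2 ∂ν) + c)) :=
              mul_le_mul_of_nonneg_left (hpt x) (hρpos x).le
          _ = _ := by ring
    _ = 2 * ε * c := by
        rw [integral_const_mul, integral_add houter (hρi.mul_const c), hinv,
          integral_mul_const, hρone]
        ring
end

section
/- There exist constants C < ∞ and λ > 1, independent of the dimension, such that for every d ≥ 2 there exists a matrix A ∈ SL(d, ℤ) with the following property: for every n ∈ ℕ and every pair of C¹ ℤ^d-periodic functions f, g : ℝ^d → ℝ with ∫_{[0,1)^d} f dx = ∫_{[0,1)^d} g dx = 0, one has | ∫_{[0,1)^d} f(A^n x) g(x) dx | ≤ C λ^{−n/2} ‖∇f‖_{L²([0,1)^d)} ‖∇g‖_{L²([0,1)^d)}. In other words, the toral automorphism x ↦ Ax (mod ℤ^d) is Lebesgue exponentially mixing with a rate whose constants are independent of the dimension d. -/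
open MeasureTheory

/-- A matrix `B` is expanding at rate `r`, with constant `K`, along pairs of integer vectors. -/
def ExpandsIntegerVectors {ι : Type*} [Fintype ι] [DecidableEq ι] (K r : ℝ)
    (B : Matrix ι ι ℤ) : Prop :=
  ∀ (n : ℕ) (k : ι → ℤ), k ≠ 0 →
    r ^ n ≤ K * (∑ i, (k i : ℝ) ^ 2) * ∑ i, (((B ^ n).mulVec k i : ℤ) : ℝ) ^ 2

/-- A homogeneous integer function that is anisotropic modulo `2` has no nontrivial integer zero. -/
theorem ne_zero_of_even_descent {ι : Type*} [Fintype ι] (N : (ι → ℤ) → ℤ) (e : ℕ)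
    (hom : ∀ k, N (2 • k) = 2 ^ e * N k)
    (aniso : ∀ k, N k = 0 → ∀ i, 2 ∣ k i) {k : ι → ℤ} (hk : k ≠ 0) : N k ≠ 0 := by
  suffices H : ∀ s : ℕ, ∀ k : ι → ℤ, ∑ i, (k i).natAbs = s → N k = 0 → k = 0 from
    fun h => hk (H _ k rfl h)
  intro s
  induction s using Nat.strong_induction_on with
  | _ s ih =>
    intro k hs h
    by_contra hne
    choose j hj using aniso k h
    have hkj : k = 2 • j := by ext i; simp [hj i]
    have hj0 : j ≠ 0 := by rintro rfl; simp at hkj; exact hne hkj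
    have hNj : N j = 0 := by
      rw [hkj, hom] at h
      simpa using h
    have hsum : ∑ i, (k i).natAbs = 2 * ∑ i, (j i).natAbs := by
      rw [Finset.mul_sum]
      exact Finset.sum_congr rfl fun i _ => by rw [hj i, Int.natAbs_mul]; rfl
    have hpos : 0 < ∑ i, (j i).natAbs := by
      obtain ⟨i, hi⟩ := Function.ne_iff.mp hj0
      exact Finset.sum_pos' (fun _ _ => Nat.zero_le _)
        ⟨i, Finset.mem_univ _, Int.natAbs_pos.mpr hi⟩
    exact hj0 (ih _ (by omega) j rfl hNj)

theorem one_le_sum_sq {ι : Type*} [Fintype ι] {k : ι → ℤ} (hk : k ≠ 0) :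
    (1 : ℝ) ≤ ∑ i, (k i : ℝ) ^ 2 := by
  obtain ⟨i, hi⟩ := Function.ne_iff.mp hk
  have h1 : (1 : ℤ) ≤ (k i) ^ 2 := by
    have : 0 < (k i) ^ 2 := sq_pos_of_ne_zero hi
    omega
  calc (1 : ℝ) ≤ (k i : ℝ) ^ 2 := by exact_mod_cast h1
    _ ≤ _ := Finset.single_le_sum (f := fun i => (k i : ℝ) ^ 2)
      (fun _ _ => sq_nonneg _) (Finset.mem_univ i)

theorem pow_mul_iterate_eq {ι : Type*} [Fintype ι] [DecidableEq ι] {B : Matrix ι ι ℤ} {θ : ℝ}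
    {q : (ι → ℤ) → ℝ} (h : ∀ k, θ * q (B.mulVec k) = q k) (n : ℕ) (k : ι → ℤ) :
    θ ^ n * q ((B ^ n).mulVec k) = q k := by
  induction n with
  | zero => simp
  | succ n ih =>
    rw [pow_succ θ, pow_succ' B, ← Matrix.mulVec_mulVec, ← ih, ← h ((B ^ n).mulVec k)]
    ring

/-- The companion-type block acting on `ℤ[θ]`, `θ² = 3θ - 1`. -/
def quadraticBlock : Matrix (Fin 2) (Fin 2) ℤ := !![0, -1; 1, 3]

/-- The companion-type block acting on `ℤ[θ]`, `θ³ = 1 - θ`. -/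
def cubicBlock : Matrix (Fin 3) (Fin 3) ℤ := !![0, 0, 1; 1, 0, -1; 0, 1, 0]

theorem quadraticBlock_det : quadraticBlock.det = 1 := by
  simp [quadraticBlock, Matrix.det_fin_two]

theorem cubicBlock_det : cubicBlock.det = 1 := by
  simp [cubicBlock, Matrix.det_fin_three]

theorem quadraticForm_ne_zero {k : Fin 2 → ℤ} (hk : k ≠ 0) :
    k 0 ^ 2 + 3 * k 0 * k 1 + k 1 ^ 2 ≠ 0 := by
  refine ne_zero_of_even_descent (fun k : Fin 2 → ℤ => k 0 ^ 2 + 3 * k 0 * k 1 + k 1 ^ 2) 2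
    (fun k => by simp; ring) (fun k h => ?_) hk
  have h2 := congrArg (Int.cast : ℤ → ZMod 2) h
  push_cast at h2
  have key : ∀ a b : ZMod 2, a ^ 2 + 3 * a * b + b ^ 2 = 0 → a = 0 ∧ b = 0 := by decide
  obtain ⟨h0, h1⟩ := key _ _ h2
  rw [ZMod.intCast_zmod_eq_zero_iff_dvd _ 2] at h0 h1
  intro i
  fin_cases i
  exacts [h0, h1]

theorem cubicForm_ne_zero {k : Fin 3 → ℤ} (hk : k ≠ 0) :
    k 0 * ((k 0 - k 2) ^ 2 - k 1 * (k 2 - k 1)) - k 2 * (k 1 * (k 0 - k 2) - k 2 * (k 2 - k 1))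
      + k 1 * (k 1 ^ 2 - k 2 * (k 0 - k 2)) ≠ 0 := by
  refine ne_zero_of_even_descent (fun k : Fin 3 → ℤ =>
    k 0 * ((k 0 - k 2) ^ 2 - k 1 * (k 2 - k 1)) - k 2 * (k 1 * (k 0 - k 2) - k 2 * (k 2 - k 1))
      + k 1 * (k 1 ^ 2 - k 2 * (k 0 - k 2))) 3
    (fun k => by simp; ring) (fun k h => ?_) hk
  have h2 := congrArg (Int.cast : ℤ → ZMod 2) h
  push_cast at h2
  have key : ∀ a b c : ZMod 2, a * ((a - c) ^ 2 - b * (c - b)) - c * (b * (a - c) - c * (c - b))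
      + b * (b ^ 2 - c * (a - c)) = 0 → a = 0 ∧ b = 0 ∧ c = 0 := by decide
  obtain ⟨h0, h1, h2⟩ := key _ _ _ h2
  rw [ZMod.intCast_zmod_eq_zero_iff_dvd _ 2] at h0 h1 h2
  intro i
  fin_cases i
  exacts [h0, h1, h2]

theorem pow_le_of_pow_mul_eq {θ x y : ℝ} (hθ0 : 0 < θ) (hθ : θ ≤ 4 / 5) {n : ℕ}
    (h : θ ^ n * x = y) : (5 / 4 : ℝ) ^ n * |y| ≤ |x| := by
  rw [← h, abs_mul, abs_of_pos (pow_pos hθ0 n), ← mul_assoc, ← mul_pow]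
  exact mul_le_of_le_one_left (abs_nonneg x) (pow_le_one₀ (by positivity) (by linarith))

theorem quadraticBlock_expands : ExpandsIntegerVectors 20 (5 / 4) quadraticBlock := by
  intro n k hk
  obtain ⟨θ, hθ0, hθ1, hθ⟩ : ∃ θ : ℝ, 0 < θ ∧ θ ≤ 4 / 5 ∧ θ ^ 2 = 3 * θ - 1 := by
    have h5 : Real.sqrt 5 ^ 2 = 5 := Real.sq_sqrt (by norm_num)
    have h0 : 0 ≤ Real.sqrt 5 := Real.sqrt_nonneg 5
    exact ⟨(3 - Real.sqrt 5) / 2, by nlinarith, by nlinarith, by nlinarith⟩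
  set q : (Fin 2 → ℤ) → ℝ := fun k => k 0 + k 1 * (3 - θ) with hq
  have hstep : ∀ k, θ * q (quadraticBlock.mulVec k) = q k := by
    intro k
    simp [hq, quadraticBlock, dotProduct, Fin.sum_univ_two]
    linear_combination (-(k 0 : ℝ) - 3 * k 1) * hθ
  have hgrow := pow_le_of_pow_mul_eq hθ0 hθ1 (pow_mul_iterate_eq hstep n k)
  set m := (quadraticBlock ^ n).mulVec k
  have hN : (1 : ℝ) ≤ (q k * (k 0 + k 1 * θ)) ^ 2 := by
    have h1 : (1 : ℤ) ≤ (k 0 ^ 2 + 3 * k 0 * k 1 + k 1 ^ 2) ^ 2 := by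
      have := pow_pos (abs_pos.mpr (quadraticForm_ne_zero hk)) 2
      rw [sq_abs] at this
      omega
    have h2 : q k * (k 0 + k 1 * θ) = ((k 0 ^ 2 + 3 * k 0 * k 1 + k 1 ^ 2 : ℤ) : ℝ) := by
      push_cast
      simp only [hq]
      linear_combination (-(k 1 : ℝ) ^ 2) * hθ
    rw [h2]
    exact_mod_cast h1
  simp only [Fin.sum_univ_two]
  have hl : ((k 0 : ℝ) + k 1 * θ) ^ 2 ≤ 2 * ((k 0 : ℝ) ^ 2 + (k 1 : ℝ) ^ 2) := by
    nlinarith [sq_nonneg ((k 0 : ℝ) - k 1 * θ), mul_nonneg (sq_nonneg (k 1 : ℝ))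
      (show 0 ≤ 1 - θ ^ 2 by nlinarith)]
  have hqm : q m ^ 2 ≤ 10 * ((m 0 : ℝ) ^ 2 + (m 1 : ℝ) ^ 2) := by
    simp only [hq]
    nlinarith [sq_nonneg ((m 0 : ℝ) * (3 - θ) - m 1), mul_nonneg
      (add_nonneg (sq_nonneg (m 0 : ℝ)) (sq_nonneg (m 1 : ℝ)))
      (show 0 ≤ 9 - (3 - θ) ^ 2 by nlinarith)]
  have hr : (1 : ℝ) ≤ (5 / 4 : ℝ) ^ n := one_le_pow₀ (by norm_num)
  have hsq : ((5 / 4 : ℝ) ^ n) ^ 2 * q k ^ 2 ≤ q m ^ 2 := by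
    rw [← mul_pow, ← sq_abs, ← sq_abs (q m), abs_mul, abs_of_pos (by positivity)]
    gcongr
  calc (5 / 4 : ℝ) ^ n ≤ ((5 / 4 : ℝ) ^ n) ^ 2 := by nlinarith
    _ ≤ ((5 / 4 : ℝ) ^ n) ^ 2 * (q k * (k 0 + k 1 * θ)) ^ 2 :=
      le_mul_of_one_le_right (by positivity) hN
    _ = (((5 / 4 : ℝ) ^ n) ^ 2 * q k ^ 2) * (k 0 + k 1 * θ) ^ 2 := by ring
    _ ≤ (10 * ((m 0 : ℝ) ^ 2 + (m 1 : ℝ) ^ 2)) * (2 * ((k 0 : ℝ) ^ 2 + (k 1 : ℝ) ^ 2)) := by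
      exact mul_le_mul (hsq.trans hqm) hl (sq_nonneg _) (by positivity)
    _ = _ := by ring

theorem abs_cubicConjugate_le {θ : ℝ} (hθ0 : 0 ≤ θ) (hθ1 : θ ≤ 1) (a b c : ℝ) :
    |((a - c) ^ 2 - b * (c - b)) - (b * (a - c) - c * (c - b)) * θ + (b ^ 2 - c * (a - c)) * θ ^ 2|
      ≤ 5 * (a ^ 2 + b ^ 2 + c ^ 2) := by
  have hα : |(a - c) ^ 2 - b * (c - b)| ≤ 5 / 2 * (a ^ 2 + b ^ 2 + c ^ 2) :=
    abs_le.mpr ⟨by nlinarith [sq_nonneg (a - c), sq_nonneg (b - c), sq_nonneg a],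
      by nlinarith [sq_nonneg (a + c), sq_nonneg (b + c), sq_nonneg a]⟩
  have hβ : |b * (a - c) - c * (c - b)| ≤ a ^ 2 + b ^ 2 + c ^ 2 :=
    abs_le.mpr ⟨by nlinarith [sq_nonneg (a + b), sq_nonneg c],
      by nlinarith [sq_nonneg (a - b), sq_nonneg c]⟩
  have hγ : |b ^ 2 - c * (a - c)| ≤ 3 / 2 * (a ^ 2 + b ^ 2 + c ^ 2) :=
    abs_le.mpr ⟨by nlinarith [sq_nonneg (a - c), sq_nonneg b],
      by nlinarith [sq_nonneg (a + c), sq_nonneg a]⟩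
  have hβθ := mul_le_of_le_one_right (abs_nonneg (b * (a - c) - c * (c - b))) hθ1
  have hγθ := mul_le_of_le_one_right (abs_nonneg (b ^ 2 - c * (a - c)))
    (pow_le_one₀ hθ0 hθ1 (n := 2))
  have htri : ∀ x y z : ℝ, |x - y + z| ≤ |x| + |y| + |z| := fun x y z =>
    (abs_add_le _ _).trans (add_le_add_left (abs_sub _ _) _)
  refine (htri _ _ _).trans ?_
  rw [abs_mul, abs_mul, abs_of_nonneg hθ0, abs_of_nonneg (sq_nonneg θ)]
  linarith

theorem cubicBlock_expands : ExpandsIntegerVectors 20 (5 / 4) cubicBlock := by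
  intro n k hk
  obtain ⟨θ, hθ0, hθ1, hθ⟩ : ∃ θ : ℝ, 0 < θ ∧ θ ≤ 4 / 5 ∧ θ ^ 3 = 1 - θ := by
    obtain ⟨θ, ⟨h0, h1⟩, h⟩ := intermediate_value_Icc (f := fun x : ℝ => x ^ 3 + x)
      (show (1 / 2 : ℝ) ≤ 4 / 5 by norm_num) (by fun_prop)
      (show (1 : ℝ) ∈ Set.Icc _ _ by norm_num)
    exact ⟨θ, by linarith, h1, by simp only at h; linarith⟩
  set q : (Fin 3 → ℤ) → ℝ := fun k =>
    ((k 0 - k 2) ^ 2 - k 1 * (k 2 - k 1)) - (k 1 * (k 0 - k 2) - k 2 * (k 2 - k 1)) * θ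
      + (k 1 ^ 2 - k 2 * (k 0 - k 2)) * θ ^ 2 with hq
  have hstep : ∀ k, θ * q (cubicBlock.mulVec k) = q k := by
    intro k
    simp [hq, cubicBlock, dotProduct, Fin.sum_univ_three]
    linear_combination ((k 0 - k 2 : ℝ) ^ 2 - (k 1 : ℝ) * (k 2 - k 1)) * hθ
  have hgrow := pow_le_of_pow_mul_eq hθ0 hθ1 (pow_mul_iterate_eq hstep n k)
  set m := (cubicBlock ^ n).mulVec k
  have hN : (1 : ℝ) ≤ (q k * (k 0 + k 1 * θ + k 2 * θ ^ 2)) ^ 2 := by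
    have h1 : (1 : ℤ) ≤ (k 0 * ((k 0 - k 2) ^ 2 - k 1 * (k 2 - k 1))
        - k 2 * (k 1 * (k 0 - k 2) - k 2 * (k 2 - k 1))
        + k 1 * (k 1 ^ 2 - k 2 * (k 0 - k 2))) ^ 2 := by
      have := pow_pos (abs_pos.mpr (cubicForm_ne_zero hk)) 2
      rw [sq_abs] at this
      omega
    have h2 : q k * (k 0 + k 1 * θ + k 2 * θ ^ 2) = ((k 0 * ((k 0 - k 2) ^ 2 - k 1 * (k 2 - k 1))
        - k 2 * (k 1 * (k 0 - k 2) - k 2 * (k 2 - k 1))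
        + k 1 * (k 1 ^ 2 - k 2 * (k 0 - k 2)) : ℤ) : ℝ) := by
      push_cast
      simp only [hq]
      linear_combination ((k 1 : ℝ) * (k 1 ^ 2 - k 2 * (k 0 - k 2))
        - k 2 * (k 1 * (k 0 - k 2) - k 2 * (k 2 - k 1))
        + k 2 * (k 1 ^ 2 - k 2 * (k 0 - k 2)) * θ) * hθ
    rw [h2]
    exact_mod_cast h1
  have hs := one_le_sum_sq hk
  simp only [Fin.sum_univ_three] at hs ⊢
  have hθ2 : θ ^ 2 ≤ 1 := by nlinarith
  have hl : ((k 0 : ℝ) + k 1 * θ + k 2 * θ ^ 2) ^ 2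
      ≤ 3 * ((k 0 : ℝ) ^ 2 + (k 1 : ℝ) ^ 2 + (k 2 : ℝ) ^ 2) := by
    have h1 : (k 1 * θ) ^ 2 ≤ (k 1 : ℝ) ^ 2 := by
      rw [mul_pow]; exact mul_le_of_le_one_right (sq_nonneg _) hθ2
    have h2 : (k 2 * θ ^ 2) ^ 2 ≤ (k 2 : ℝ) ^ 2 := by
      rw [mul_pow]; exact mul_le_of_le_one_right (sq_nonneg _) (pow_le_one₀ (sq_nonneg _) hθ2)
    nlinarith [sq_nonneg ((k 0 : ℝ) - k 1 * θ), sq_nonneg ((k 0 : ℝ) - k 2 * θ ^ 2),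
      sq_nonneg (k 1 * θ - k 2 * θ ^ 2)]
  have hqm : |q m| ≤ 5 * ((m 0 : ℝ) ^ 2 + (m 1 : ℝ) ^ 2 + (m 2 : ℝ) ^ 2) :=
    abs_cubicConjugate_le hθ0.le (by linarith) _ _ _
  generalize (k 0 : ℝ) ^ 2 + (k 1 : ℝ) ^ 2 + (k 2 : ℝ) ^ 2 = s at hs hl ⊢
  have hS : 0 ≤ (m 0 : ℝ) ^ 2 + (m 1 : ℝ) ^ 2 + (m 2 : ℝ) ^ 2 := by positivity
  generalize (m 0 : ℝ) ^ 2 + (m 1 : ℝ) ^ 2 + (m 2 : ℝ) ^ 2 = S at hqm hS ⊢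
  refine abs_le_of_sq_le_sq' ?_ (by positivity) |>.2
  calc ((5 / 4 : ℝ) ^ n) ^ 2
      ≤ ((5 / 4 : ℝ) ^ n) ^ 2 * (q k * (k 0 + k 1 * θ + k 2 * θ ^ 2)) ^ 2 :=
        le_mul_of_one_le_right (by positivity) hN
    _ = ((5 / 4 : ℝ) ^ n * |q k|) ^ 2 * (k 0 + k 1 * θ + k 2 * θ ^ 2) ^ 2 := by
      rw [mul_pow _ |q k|, sq_abs]; ring
    _ ≤ (5 * S) ^ 2 * (3 * s) := by
      have := hgrow.trans hqm
      gcongr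
    _ ≤ (20 * s * S) ^ 2 := by
      nlinarith [mul_nonneg (sq_nonneg S) (show 0 ≤ s * (s - 1) by nlinarith), sq_nonneg (S * s)]

theorem ExpandsIntegerVectors.fromBlocks {ι κ : Type*} [Fintype ι] [DecidableEq ι] [Fintype κ]
    [DecidableEq κ] {K r : ℝ} (hK : 0 ≤ K) {B : Matrix ι ι ℤ} {D : Matrix κ κ ℤ}
    (hB : ExpandsIntegerVectors K r B) (hD : ExpandsIntegerVectors K r D) :
    ExpandsIntegerVectors K r (Matrix.fromBlocks B 0 0 D) := by
  intro n k hk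
  rw [Matrix.fromBlocks_diagonal_pow, Matrix.fromBlocks_mulVec]
  simp only [Fintype.sum_sum_type, Matrix.zero_mulVec, add_zero, zero_add, Sum.elim_inl,
    Sum.elim_inr]
  have h1 : 0 ≤ ∑ i, (k (Sum.inl i) : ℝ) ^ 2 := Finset.sum_nonneg fun i _ => sq_nonneg _
  have h2 : 0 ≤ ∑ i, (k (Sum.inr i) : ℝ) ^ 2 := Finset.sum_nonneg fun i _ => sq_nonneg _
  have h3 : 0 ≤ ∑ i, (((B ^ n).mulVec (k ∘ Sum.inl) i : ℤ) : ℝ) ^ 2 :=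
    Finset.sum_nonneg fun i _ => sq_nonneg _
  have h4 : 0 ≤ ∑ i, (((D ^ n).mulVec (k ∘ Sum.inr) i : ℤ) : ℝ) ^ 2 :=
    Finset.sum_nonneg fun i _ => sq_nonneg _
  by_cases hl : k ∘ Sum.inl = 0
  · have hr : k ∘ Sum.inr ≠ 0 := fun hr => hk (by
      ext (i | i)
      exacts [congrFun hl i, congrFun hr i])
    refine (hD n _ hr).trans ?_
    simp only [Function.comp_apply]
    gcongr <;> linarith
  · refine (hB n _ hl).trans ?_
    simp only [Function.comp_apply]
    gcongr <;> linarith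

theorem ExpandsIntegerVectors.reindex {ι κ : Type*} [Fintype ι] [DecidableEq ι] [Fintype κ]
    [DecidableEq κ] {K r : ℝ} {B : Matrix ι ι ℤ} (hB : ExpandsIntegerVectors K r B) (e : ι ≃ κ) :
    ExpandsIntegerVectors K r (B.reindex e e) := by
  intro n k hk
  have hpow : (B.reindex e e) ^ n = (B ^ n).reindex e e :=
    (map_pow (Matrix.reindexAlgEquiv ℤ ℤ e) B n).symm
  have hke : k ∘ e ≠ 0 := fun h => hk (by
    ext i
    simpa using congrFun h (e.symm i))
  have := hB n (k ∘ e) hke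
  rw [hpow, Matrix.reindex_apply, Matrix.submatrix_mulVec_equiv]
  simpa [← e.sum_comp] using this

/-- In every dimension `d ≥ 2` there is a unimodular integer matrix expanding integer vectors at a
rate independent of `d`. -/
theorem exists_expandsIntegerVectors (d : ℕ) (hd : 2 ≤ d) :
    ∃ B : Matrix (Fin d) (Fin d) ℤ, B.det = 1 ∧ ExpandsIntegerVectors 20 (5 / 4) B := by
  induction d using Nat.strong_induction_on with
  | _ d ih =>
    obtain rfl | rfl | hd4 : d = 2 ∨ d = 3 ∨ 4 ≤ d := by omega
    · exact ⟨_, quadraticBlock_det, quadraticBlock_expands⟩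
    · exact ⟨_, cubicBlock_det, cubicBlock_expands⟩
    · obtain ⟨e, rfl⟩ : ∃ e, d = e + 2 := ⟨d - 2, by omega⟩
      obtain ⟨B, hdet, hB⟩ := ih e (by omega) (by omega)
      refine ⟨(Matrix.fromBlocks B 0 0 quadraticBlock).reindex finSumFinEquiv finSumFinEquiv, ?_,
        (hB.fromBlocks (by norm_num) quadraticBlock_expands).reindex _⟩
      rw [Matrix.det_reindex_self, Matrix.det_fromBlocks_zero₂₁, hdet, quadraticBlock_det, one_mul]

namespace UnitAddTorus

noncomputable local instance : MeasureSpace UnitAddCircle := ⟨AddCircle.haarAddCircle⟩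

local instance : Measure.IsAddHaarMeasure (volume : Measure UnitAddCircle) :=
  inferInstanceAs (Measure.IsAddHaarMeasure AddCircle.haarAddCircle)

local instance : IsProbabilityMeasure (volume : Measure UnitAddCircle) :=
  inferInstanceAs (IsProbabilityMeasure AddCircle.haarAddCircle)

variable {d : ℕ}

/-- The covering map from `ℝ^d` to the torus. -/
def proj (x : Fin d → ℝ) : UnitAddTorus (Fin d) := fun i => (x i : UnitAddCircle)

theorem isOpenQuotientMap_proj : IsOpenQuotientMap (proj (d := d)) :=
  IsOpenQuotientMap.piMap fun _ => QuotientAddGroup.isOpenQuotientMap_mk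

theorem proj_add (x y : Fin d → ℝ) : proj (x + y) = proj x + proj y := by
  ext i
  simp [proj]

theorem continuous_proj : Continuous (proj (d := d)) := isOpenQuotientMap_proj.continuous

theorem proj_single_one (i : Fin d) : proj (Pi.single i 1) = 0 := by
  ext j
  obtain rfl | h := eq_or_ne j i
  · simp [proj]
  · simp [proj, h]

theorem proj_zero : proj (0 : Fin d → ℝ) = 0 := by
  ext j
  simp [proj]

theorem proj_eq_proj_iff {x y : Fin d → ℝ} :
    proj x = proj y ↔ ∃ m : Fin d → ℤ, x + (fun i => (m i : ℝ)) = y := by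
  constructor
  · intro h
    have h' : ∀ i, ∃ n : ℤ, x i + n = y i := fun i => by
      obtain ⟨n, hn⟩ := AddSubgroup.mem_zmultiples_iff.mp (QuotientAddGroup.eq.mp (congrFun h i))
      exact ⟨n, by simp at hn; linarith⟩
    choose m hm using h'
    exact ⟨m, funext hm⟩
  · rintro ⟨m, rfl⟩
    ext i
    simp [proj]

/-- A continuous periodic function descends to the torus. -/
theorem exists_continuousMap_comp_proj {F : (Fin d → ℝ) → ℝ} (hF : Continuous F)
    (hper : Per d F) :
    ∃ G : C(UnitAddTorus (Fin d), ℂ), ∀ x, G (proj x) = F x := by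
  obtain ⟨s, hs⟩ := (isOpenQuotientMap_proj (d := d)).surjective.hasRightInverse
  have hG : ∀ x, F (s (proj x)) = F x := fun x => by
    obtain ⟨m, hm⟩ := proj_eq_proj_iff.mp (hs (proj x))
    rw [← hper _ m, hm]
  refine ⟨⟨fun y => F (s y), ?_⟩, fun x => congrArg Complex.ofReal (hG x)⟩
  rw [(isOpenQuotientMap_proj (d := d)).isQuotientMap.continuous_iff]
  exact (Complex.continuous_ofReal.comp hF).congr fun x => by simp [hG]

theorem integral_eq_setIntegral_box (G : UnitAddTorus (Fin d) → ℂ) :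
    ∫ y, G y = ∫ x in box d, G (proj x) := by
  rw [integral_preimage G 0]
  refine setIntegral_congr_set ?_
  have h1 := Measure.univ_pi_Ioc_ae_eq_Icc (μ := fun _ : Fin d => (volume : Measure ℝ))
    (f := fun _ => 0) (g := fun _ => 1)
  have h2 := Measure.univ_pi_Ico_ae_eq_Icc (μ := fun _ : Fin d => (volume : Measure ℝ))
    (f := fun _ => 0) (g := fun _ => 1)
  refine Filter.EventuallyEq.trans (Filter.EventuallyEq.of_eq ?_) (h1.trans h2.symm)
  ext x
  exact ⟨fun h i _ => by simpa using h i, fun h i => by simpa using h i trivial⟩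

theorem mFourier_proj (n : Fin d → ℤ) (x : Fin d → ℝ) :
    mFourier n (proj x) = Complex.exp (2 * Real.pi * Complex.I * ∑ i, (n i : ℂ) * x i) := by
  simp only [mFourier, ContinuousMap.coe_mk, proj, fourier_coe_apply, ← Complex.exp_sum,
    Finset.mul_sum]
  congr 1
  exact Finset.sum_congr rfl fun i _ => by push_cast; ring

/-- The endomorphism of the torus induced by an integer matrix. -/
def matrixHom (A : Matrix (Fin d) (Fin d) ℤ) : UnitAddTorus (Fin d) →+ UnitAddTorus (Fin d) where
  toFun y i := ∑ j, A i j • y j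
  map_zero' := by ext; simp
  map_add' y z := by ext; simp [Finset.sum_add_distrib]

theorem continuous_matrixHom (A : Matrix (Fin d) (Fin d) ℤ) : Continuous (matrixHom A) := by
  refine continuous_pi fun i => ?_
  change Continuous fun y : UnitAddTorus (Fin d) => ∑ j, A i j • y j
  exact continuous_finsetSum _ fun j _ => (continuous_apply (A := fun _ => UnitAddCircle) j).zsmul _

theorem matrixHom_proj (A : Matrix (Fin d) (Fin d) ℤ) (x : Fin d → ℝ) :
    matrixHom A (proj x) = proj ((A.map (Int.cast : ℤ → ℝ)).mulVec x) := by
  ext i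
  simp only [matrixHom, AddMonoidHom.coe_mk, ZeroHom.coe_mk, proj, Matrix.mulVec, dotProduct]
  refine Eq.trans ?_ (map_sum (QuotientAddGroup.mk' (AddSubgroup.zmultiples (1 : ℝ))) _ _).symm
  refine Finset.sum_congr rfl fun j _ => ?_
  simp [-zsmul_eq_mul]

theorem surjective_matrixHom {A : Matrix (Fin d) (Fin d) ℤ} (hA : A.det = 1) :
    Function.Surjective (matrixHom A) := by
  intro y
  obtain ⟨x, rfl⟩ := isOpenQuotientMap_proj.surjective y
  refine ⟨matrixHom A⁻¹ (proj x), ?_⟩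
  rw [matrixHom_proj, matrixHom_proj, Matrix.mulVec_mulVec]
  have : A.map (Int.cast : ℤ → ℝ) * A⁻¹.map (Int.cast : ℤ → ℝ) = 1 := by
    have h := congrArg (fun M => M.map (Int.cast : ℤ → ℝ))
      (Matrix.mul_nonsing_inv A (by simp [hA]))
    simpa [Matrix.map_mul_intCast] using h
  rw [this, Matrix.one_mulVec]

theorem measurePreserving_matrixHom {A : Matrix (Fin d) (Fin d) ℤ} (hA : A.det = 1) :
    MeasurePreserving (matrixHom A) volume volume :=
  AddMonoidHom.measurePreserving (continuous_matrixHom A) (surjective_matrixHom hA) rfl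

theorem mFourier_transpose_mulVec (A : Matrix (Fin d) (Fin d) ℤ) (m : Fin d → ℤ)
    (y : UnitAddTorus (Fin d)) :
    mFourier (A.transpose.mulVec m) y = mFourier m (matrixHom A y) := by
  obtain ⟨x, rfl⟩ := isOpenQuotientMap_proj.surjective y
  rw [matrixHom_proj, mFourier_proj, mFourier_proj]
  congr 2
  simp only [Matrix.mulVec, dotProduct, Matrix.transpose_apply, Matrix.map_apply]
  push_cast
  simp only [Finset.sum_mul, Finset.mul_sum]
  rw [Finset.sum_comm]
  exact Finset.sum_congr rfl fun i _ => Finset.sum_congr rfl fun j _ => by ring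

theorem mFourierCoeff_comp_matrixHom {A : Matrix (Fin d) (Fin d) ℤ} (hA : A.det = 1)
    (F : C(UnitAddTorus (Fin d), ℂ)) (m : Fin d → ℤ) :
    mFourierCoeff (fun y => F (matrixHom A y)) (A.transpose.mulVec m) = mFourierCoeff F m := by
  have hmp := measurePreserving_matrixHom hA
  simp only [mFourierCoeff, ← Matrix.mulVec_neg, mFourier_transpose_mulVec]
  rw [← integral_map (f := fun y => mFourier (-m) y • F y) hmp.aemeasurable
    (by fun_prop : Continuous fun y => mFourier (-m) y • F y).aestronglyMeasurable, hmp.map_eq]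

/-- The integral of a continuous partial derivative over the torus vanishes. -/
theorem integral_partialDeriv_eq_zero {G G' : C(UnitAddTorus (Fin d), ℂ)} {i : Fin d}
    (h : ∀ y : UnitAddTorus (Fin d),
      HasDerivAt (fun t : ℝ => G (y + proj (Pi.single i t))) (G' y) 0) :
    ∫ y, G' y = 0 := by
  have hderiv : ∀ (y : UnitAddTorus (Fin d)) (t : ℝ),
      HasDerivAt (fun t : ℝ => G (y + proj (Pi.single i t)))
      (G' (y + proj (Pi.single i t))) t := fun y t => by
    have := HasDerivAt.comp_sub_const t t (by simpa using! h (y + proj (Pi.single i t)))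
    refine this.congr_of_eventuallyEq (.of_forall fun s => ?_)
    dsimp only
    rw [add_assoc, ← proj_add, ← Pi.single_add, add_sub_cancel]
  have hcont : Continuous fun p : UnitAddTorus (Fin d) × ℝ =>
      G' (p.1 + proj (Pi.single i p.2)) :=
    G'.continuous.comp (continuous_fst.add
      (continuous_proj.comp ((continuous_single i).comp continuous_snd)))
  have hftc : ∀ y : UnitAddTorus (Fin d),
      ∫ t in (0 : ℝ)..1, G' (y + proj (Pi.single i t)) = 0 := fun y => by
    rw [intervalIntegral.integral_eq_sub_of_hasDerivAt (fun t _ => hderiv y t)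
      ((hcont.comp (Continuous.prodMk_right y)).intervalIntegrable _ _)]
    simp [proj_single_one, proj_zero]
  have hswap : ∫ y : UnitAddTorus (Fin d), ∫ t in (0 : ℝ)..1, G' (y + proj (Pi.single i t))
      = ∫ t in (0 : ℝ)..1, ∫ y : UnitAddTorus (Fin d), G' (y + proj (Pi.single i t)) := by
    simp only [intervalIntegral.integral_of_le zero_le_one]
    rw [integral_integral_swap]
    refine Integrable.mono' (integrable_const ‖G'‖) hcont.aestronglyMeasurable
      (.of_forall fun p => G'.norm_coe_le_norm _)
  simp only [hftc, integral_zero, integral_add_right_eq_self] at hswap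
  simpa using hswap.symm

theorem hasDerivAt_mFourier (n : Fin d → ℤ) (i : Fin d) (y : UnitAddTorus (Fin d)) :
    HasDerivAt (fun t : ℝ => mFourier n (y + proj (Pi.single i t)))
      (2 * Real.pi * Complex.I * n i * mFourier n y) 0 := by
  obtain ⟨x, rfl⟩ := isOpenQuotientMap_proj.surjective y
  have hs : ∀ t : ℝ, ∑ j, (n j : ℂ) * ((x + Pi.single i t : Fin d → ℝ) j : ℝ)
      = ∑ j, (n j : ℂ) * x j + n i * t := fun t => by
    simp [mul_add, Finset.sum_add_distrib, Pi.single_apply, apply_ite Complex.ofReal]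
  simp only [← proj_add, mFourier_proj, hs]
  have h1 : HasDerivAt (fun t : ℝ => 2 * Real.pi * Complex.I *
      (∑ j, (n j : ℂ) * x j + n i * t)) (2 * Real.pi * Complex.I * (n i * 1)) 0 :=
    (((Complex.ofRealCLM.hasDerivAt).const_mul _).const_add _).const_mul _
  convert h1.cexp using 1
  simp
  ring

theorem mFourierCoeff_partialDeriv {G G' : C(UnitAddTorus (Fin d), ℂ)} {i : Fin d}
    (h : ∀ y : UnitAddTorus (Fin d),
      HasDerivAt (fun t : ℝ => G (y + proj (Pi.single i t))) (G' y) 0)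
    (n : Fin d → ℤ) :
    mFourierCoeff G' n = 2 * Real.pi * Complex.I * n i * mFourierCoeff G n := by
  have key := integral_partialDeriv_eq_zero (G := mFourier (-n) * G) (i := i)
    (G' := mFourier (-n) * G' - (2 * Real.pi * Complex.I * n i : ℂ) • (mFourier (-n) * G))
    (fun y => by
      refine ((hasDerivAt_mFourier (-n) i y).mul (h y)).congr_deriv ?_
      simp only [ContinuousMap.sub_apply, ContinuousMap.smul_apply, ContinuousMap.mul_apply,
        smul_eq_mul, Pi.neg_apply, Int.cast_neg, Pi.single_zero, proj_zero, add_zero]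
      ring)
  have hint : ∀ H : C(UnitAddTorus (Fin d), ℂ), Integrable H := fun H =>
    H.continuous.integrable_of_hasCompactSupport (HasCompactSupport.of_compactSpace _)
  simp only [ContinuousMap.sub_apply, ContinuousMap.smul_apply] at key
  rw [integral_sub (hint _)
    (by exact (hint (mFourier (-n) * G)).smul (2 * Real.pi * Complex.I * n i : ℂ)),
    integral_smul, sub_eq_zero] at key
  simpa [mFourierCoeff] using key


open scoped ComplexConjugate

theorem hasSum_conj_mFourierCoeff_mul (F G : C(UnitAddTorus (Fin d), ℂ)) :
    HasSum (fun n => conj (mFourierCoeff F n) * mFourierCoeff G n) (∫ y, conj (F y) * G y) := by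
  have h := hasSum_prod_mFourierCoeff (F.toLp 2 volume ℂ) (G.toLp 2 volume ℂ)
  simp only [mFourierCoeff_toLp] at h
  convert h using 1
  refine integral_congr_ae ?_
  filter_upwards [F.coeFn_toLp (𝕜 := ℂ) (p := 2) volume, G.coeFn_toLp (𝕜 := ℂ) (p := 2) volume]
    with y hF hG
  rw [hF, hG]

theorem hasSum_sq_norm_mFourierCoeff (F : C(UnitAddTorus (Fin d), ℂ)) :
    HasSum (fun n => ‖mFourierCoeff F n‖ ^ 2) (∫ y, ‖F y‖ ^ 2) := by
  have h := hasSum_sq_mFourierCoeff (F.toLp 2 volume ℂ)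
  simp only [mFourierCoeff_toLp] at h
  convert h using 1
  refine integral_congr_ae ?_
  filter_upwards [F.coeFn_toLp (𝕜 := ℂ) (p := 2) volume] with y hF
  rw [hF]

/-- `F' i` is the `i`-th partial derivative of `F` on the torus. -/
def HasPartialDerivs (F : C(UnitAddTorus (Fin d), ℂ)) (F' : Fin d → C(UnitAddTorus (Fin d), ℂ)) :
    Prop :=
  ∀ i, ∀ y : UnitAddTorus (Fin d),
    HasDerivAt (fun t : ℝ => F (y + proj (Pi.single i t))) (F' i y) 0

theorem HasPartialDerivs.hasSum {F : C(UnitAddTorus (Fin d), ℂ)}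
    {F' : Fin d → C(UnitAddTorus (Fin d), ℂ)} (h : HasPartialDerivs F F') :
    HasSum (fun n => (2 * Real.pi) ^ 2 * (∑ i, (n i : ℝ) ^ 2) * ‖mFourierCoeff F n‖ ^ 2)
      (∫ y, ∑ i, ‖F' i y‖ ^ 2) := by
  rw [integral_finsetSum _ fun i _ =>
    (by fun_prop : Continuous fun y => ‖F' i y‖ ^ 2).integrable_of_hasCompactSupport
      (HasCompactSupport.of_compactSpace _)]
  refine (hasSum_sum fun i _ => hasSum_sq_norm_mFourierCoeff (F' i)).congr_fun fun n => ?_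
  rw [Finset.mul_sum, Finset.sum_mul]
  refine Finset.sum_congr rfl fun i _ => ?_
  rw [mFourierCoeff_partialDeriv (h i) n]
  simp [mul_pow, abs_of_pos Real.pi_pos]

/-- Multiplication of integer vectors by a unimodular matrix, as an equivalence. -/
def mulVecEquiv {B : Matrix (Fin d) (Fin d) ℤ} (hB : B.det = 1) : (Fin d → ℤ) ≃ (Fin d → ℤ) where
  toFun := B.mulVec
  invFun := B.adjugate.mulVec
  left_inv k := by simp [Matrix.adjugate_mul, hB]
  right_inv k := by simp [Matrix.mul_adjugate, hB]

theorem norm_integral_conj_comp_matrixHom_mul_le {A : Matrix (Fin d) (Fin d) ℤ} (hA : A.det = 1)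
    {κ : ℝ} (hκ : 0 ≤ κ)
    (hexp : ∀ k : Fin d → ℤ, k ≠ 0 →
      1 ≤ κ ^ 2 * (∑ i, (k i : ℝ) ^ 2) * ∑ i, ((A.transpose.mulVec k i : ℤ) : ℝ) ^ 2)
    {F G : C(UnitAddTorus (Fin d), ℂ)} {F' G' : Fin d → C(UnitAddTorus (Fin d), ℂ)}
    (hF : HasPartialDerivs F F') (hG : HasPartialDerivs G G') (hF0 : ∫ y, F y = 0) :
    ‖∫ y, conj (F (matrixHom A y)) * G y‖ ≤
      κ * √(∫ y, ∑ i, ‖F' i y‖ ^ 2) * √(∫ y, ∑ i, ‖G' i y‖ ^ 2) := by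
  have hB : A.transpose.det = 1 := by rw [Matrix.det_transpose, hA]
  have hpair := hasSum_conj_mFourierCoeff_mul (F.comp ⟨matrixHom A, continuous_matrixHom A⟩) G
  rw [← (mulVecEquiv hB).hasSum_iff] at hpair
  have hterm : ∀ m, mFourierCoeff (F.comp ⟨matrixHom A, continuous_matrixHom A⟩)
      (mulVecEquiv hB m) = mFourierCoeff F m := mFourierCoeff_comp_matrixHom hA F
  simp only [Function.comp_def, hterm] at hpair
  have hsF := hF.hasSum
  have hsG := (mulVecEquiv hB).hasSum_iff.mpr hG.hasSum
  simp only [Function.comp_def] at hsG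
  set IF := ∫ y, ∑ i, ‖F' i y‖ ^ 2
  set IG := ∫ y, ∑ i, ‖G' i y‖ ^ 2
  set u : (Fin d → ℤ) → ℝ := fun m =>
    2 * Real.pi * √(∑ i, (m i : ℝ) ^ 2) * ‖mFourierCoeff F m‖ with hu
  set v : (Fin d → ℤ) → ℝ := fun m => 2 * Real.pi * √(∑ i, ((mulVecEquiv hB m i : ℤ) : ℝ) ^ 2) *
    ‖mFourierCoeff G (mulVecEquiv hB m)‖ with hv
  have hsq : ∀ k : Fin d → ℤ, √(∑ i, (k i : ℝ) ^ 2) ^ 2 = ∑ i, (k i : ℝ) ^ 2 := fun k =>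
    Real.sq_sqrt (Finset.sum_nonneg fun i _ => sq_nonneg _)
  have hIF : 0 ≤ IF := integral_nonneg fun y => Finset.sum_nonneg fun i _ => sq_nonneg _
  have hIG : 0 ≤ IG := integral_nonneg fun y => Finset.sum_nonneg fun i _ => sq_nonneg _
  obtain ⟨C, hC0, hC, hsum⟩ := Real.inner_le_Lp_mul_Lq_hasSum_of_nonneg (f := u) (g := v)
    Real.HolderConjugate.two_two (Real.sqrt_nonneg IF) (Real.sqrt_nonneg IG)
    (fun m => by positivity) (fun m => by positivity)
    (by simpa [hu, mul_pow, hsq, Real.sq_sqrt hIF] using hsF)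
    (by simpa [hv, mul_pow, hsq, Real.sq_sqrt hIG] using hsG)
  have hle : ∀ m, ‖conj (mFourierCoeff F m) * mFourierCoeff G (mulVecEquiv hB m)‖
      ≤ κ * (u m * v m) := by
    intro m
    rw [norm_mul, RCLike.norm_conj]
    by_cases hm : m = 0
    · subst hm
      have : mFourierCoeff F 0 = 0 := by simpa [mFourierCoeff, mFourier_zero] using hF0
      simp [hu, this]
    · have h1 : 1 ≤ κ * (√(∑ i, (m i : ℝ) ^ 2) * √(∑ i, ((mulVecEquiv hB m i : ℤ) : ℝ) ^ 2)) := by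
        rw [← one_le_sq_iff₀ (by positivity), mul_pow, mul_pow, hsq, hsq, ← mul_assoc]
        exact hexp m hm
      have h2 : 1 ≤ 2 * Real.pi := by linarith [Real.pi_gt_three]
      calc _ ≤ (2 * Real.pi * (2 * Real.pi) * (κ * (√(∑ i, (m i : ℝ) ^ 2) *
            √(∑ i, ((mulVecEquiv hB m i : ℤ) : ℝ) ^ 2)))) *
            (‖mFourierCoeff F m‖ * ‖mFourierCoeff G (mulVecEquiv hB m)‖) :=
          le_mul_of_one_le_left (by positivity)
            (one_le_mul_of_one_le_of_one_le (one_le_mul_of_one_le_of_one_le h2 h2) h1)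
        _ = _ := by simp only [hu, hv]; ring
  calc ‖∫ y, conj (F (matrixHom A y)) * G y‖
      ≤ κ * C := by
        refine le_trans (le_of_eq ?_) (tsum_of_norm_bounded (hsum.mul_left κ) hle)
        exact congrArg norm hpair.tsum_eq.symm
    _ ≤ _ := by rw [mul_assoc]; gcongr

theorem exists_continuousMap_hasPartialDerivs {f : (Fin d → ℝ) → ℝ} (hf : ContDiff ℝ 1 f)
    (hper : Per d f) :
    ∃ (F : C(UnitAddTorus (Fin d), ℂ)) (F' : Fin d → C(UnitAddTorus (Fin d), ℂ)),
      (∀ x, F (proj x) = f x) ∧ (∀ i x, F' i (proj x) = pd d f i x) ∧ HasPartialDerivs F F' := by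
  obtain ⟨F, hF⟩ := exists_continuousMap_comp_proj hf.continuous hper
  have hcont : ∀ i, Continuous (pd d f i) := fun i =>
    (hf.continuous_fderiv one_ne_zero).clm_apply continuous_const
  have hpd : ∀ i, Per d (pd d f i) := fun i x m => by
    rw [pd, ← fderiv_comp_add_right]
    simp only [hper _ m]
    rfl
  choose F' hF' using fun i => exists_continuousMap_comp_proj (hcont i) (hpd i)
  refine ⟨F, F', hF, hF', fun i y => ?_⟩
  obtain ⟨x, rfl⟩ := isOpenQuotientMap_proj.surjective y
  simp only [← proj_add, hF, hF']
  have hdiff : HasFDerivAt f (fderiv ℝ f x) (x + Pi.single i (0 : ℝ)) := by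
    simpa using (hf.differentiable one_ne_zero x).hasFDerivAt
  exact (hdiff.comp_hasDerivAt (0 : ℝ)
    ((hasDerivAt_single i (0 : ℝ)).const_add x)).ofReal_comp

theorem integral_sum_sq_norm_eq {f : (Fin d → ℝ) → ℝ} {F' : Fin d → C(UnitAddTorus (Fin d), ℂ)}
    (hF' : ∀ i x, F' i (proj x) = pd d f i x) :
    ∫ y, ∑ i, ‖F' i y‖ ^ 2 = ∫ x in box d, ∑ i, pd d f i x ^ 2 := by
  have h := integral_eq_setIntegral_box fun y => ((∑ i, ‖F' i y‖ ^ 2 : ℝ) : ℂ)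
  rw [integral_complex_ofReal, integral_complex_ofReal] at h
  simpa [hF'] using Complex.ofReal_injective h

theorem abs_setIntegral_box_comp_mulVec_mul_le {A : Matrix (Fin d) (Fin d) ℤ} (hA : A.det = 1)
    {κ : ℝ} (hκ : 0 ≤ κ)
    (hexp : ∀ k : Fin d → ℤ, k ≠ 0 →
      1 ≤ κ ^ 2 * (∑ i, (k i : ℝ) ^ 2) * ∑ i, ((A.transpose.mulVec k i : ℤ) : ℝ) ^ 2)
    {f g : (Fin d → ℝ) → ℝ} (hf : ContDiff ℝ 1 f) (hfper : Per d f) (hg : ContDiff ℝ 1 g)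
    (hgper : Per d g) (hf0 : ∫ x in box d, f x = 0) :
    |∫ x in box d, f ((A.map (Int.cast : ℤ → ℝ)).mulVec x) * g x| ≤
      κ * √(∫ x in box d, ∑ i, pd d f i x ^ 2) * √(∫ x in box d, ∑ i, pd d g i x ^ 2) := by
  obtain ⟨F, F', hF, hF', hFF'⟩ := exists_continuousMap_hasPartialDerivs hf hfper
  obtain ⟨G, G', hG, hG', hGG'⟩ := exists_continuousMap_hasPartialDerivs hg hgper
  have hF0 : ∫ y, F y = 0 := by
    rw [integral_eq_setIntegral_box]
    simp only [hF]
    rw [integral_complex_ofReal, hf0, Complex.ofReal_zero]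
  have key := norm_integral_conj_comp_matrixHom_mul_le hA hκ hexp hFF' hGG' hF0
  rw [integral_sum_sq_norm_eq hF', integral_sum_sq_norm_eq hG',
    integral_eq_setIntegral_box fun y => conj (F (matrixHom A y)) * G y] at key
  simp only [matrixHom_proj, hF, hG, Complex.conj_ofReal, ← Complex.ofReal_mul] at key
  rwa [integral_complex_ofReal, Complex.norm_real, Real.norm_eq_abs] at key

end UnitAddTorus

/-- there are dimension-independent constants `C` and `λ > 1` such that
for every `d ≥ 2` there is a toral automorphism `A ∈ SL(d,ℤ)` with
`|∫ f(Aⁿx) g(x) dx| ≤ C λ^{-n/2} ‖∇f‖_{L²} ‖∇g‖_{L²}` for all mean-zero periodic C¹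
test functions, i.e. `x ↦ Ax (mod ℤ^d)` is Lebesgue exponentially mixing at a
dimension-independent rate. -/
theorem stmt_15 :
    ∃ C lam : ℝ, 0 < C ∧ 1 < lam ∧
    ∀ d : ℕ, 2 ≤ d →
    ∃ A : Matrix (Fin d) (Fin d) ℤ, A.det = 1 ∧
    ∀ n : ℕ, ∀ f g : (Fin d → ℝ) → ℝ,
      ContDiff ℝ 1 f → Per d f → ContDiff ℝ 1 g → Per d g →
      (∫ x in box d, f x) = 0 → (∫ x in box d, g x) = 0 →
      |∫ x in box d, f (((A ^ n).map (Int.cast : ℤ → ℝ)).mulVec x) * g x|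
        ≤ C * lam ^ (-(n : ℝ) / 2) *
            Real.sqrt (∫ x in box d, ∑ i, (pd d f i x) ^ 2) *
            Real.sqrt (∫ x in box d, ∑ i, (pd d g i x) ^ 2) := by
  refine ⟨√20, 5 / 4, by positivity, by norm_num, fun d hd => ?_⟩
  obtain ⟨B, hdet, hB⟩ := exists_expandsIntegerVectors d hd
  refine ⟨B.transpose, by rw [Matrix.det_transpose, hdet], fun n f g hf hfp hg hgp hf0 _ => ?_⟩
  refine UnitAddTorus.abs_setIntegral_box_comp_mulVec_mul_le
    (by rw [Matrix.det_pow, Matrix.det_transpose, hdet, one_pow]) (by positivity)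
    (fun k hk => ?_) hf hfp hg hgp hf0
  have hκ : (√20 * (5 / 4 : ℝ) ^ (-(n : ℝ) / 2)) ^ 2 = 20 * ((5 / 4 : ℝ) ^ n)⁻¹ := by
    rw [mul_pow, Real.sq_sqrt (by norm_num), ← Real.rpow_natCast (_ ^ (_ : ℝ)),
      ← Real.rpow_mul (by norm_num), Nat.cast_ofNat, div_mul_cancel₀ _ two_ne_zero,
      Real.rpow_neg (by norm_num), Real.rpow_natCast]
  rw [hκ, Matrix.transpose_pow, Matrix.transpose_transpose]
  have hr : (0 : ℝ) < (5 / 4) ^ n := by positivity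
  calc (1 : ℝ) = ((5 / 4 : ℝ) ^ n)⁻¹ * (5 / 4) ^ n := (inv_mul_cancel₀ hr.ne').symm
    _ ≤ ((5 / 4 : ℝ) ^ n)⁻¹ * (20 * (∑ i, (k i : ℝ) ^ 2) *
        ∑ i, (((B ^ n).mulVec k i : ℤ) : ℝ) ^ 2) :=
      mul_le_mul_of_nonneg_left (hB n k hk) (by positivity)
    _ = _ := by ring
end
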